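/- arXiv:math/0610831 — 2 statements merged into one kernel-verified Lean document; each statement's English description precedes it below -/
import Mathlib

section
/- Stein–Serre theorem (used in the proof of Lemma 7): every countable abelian group A with Ext¹_ℤ(A, ℤ) = 0 is a free abelian group, i.e., a free ℤ-module. -/
open CategoryTheory

/-- If `Ext¹(X, S.X₁) = 0` for a short exact sequence `S`, then every morphism `X ⟶ S.X₃` lifts
along `S.g`. -/
theorem CategoryTheory.ShortComplex.ShortExact.exists_lift_of_subsingleton_ext
    {R C : Type*} [Ring R] [Category* C] [Abelian C] [Linear R C] [EnoughProjectives C]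
    {S : ShortComplex C} (hS : S.ShortExact) {X : C}
    (hext : Subsingleton (((Ext R C 1).obj (Opposite.op X)).obj S.X₁)) (f : X ⟶ S.X₃) :
    ∃ g : X ⟶ S.X₂, g ≫ S.g = f := by
  have := hS.mono_f
  have := hS.epi_g
  let P := projectiveResolution X
  let π : P.complex.X 0 ⟶ X := P.π.f 0
  have : Epi π := inferInstanceAs (Epi (P.π.f 0))
  have hπ : P.complex.d 1 0 ≫ π = 0 := P.complex_d_comp_π_f_zero
  let u : P.complex.X 0 ⟶ S.X₂ := Projective.factorThru (π ≫ f) S.g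
  have hu : u ≫ S.g = π ≫ f := Projective.factorThru_comp _ _
  have hdu : (P.complex.d 1 0 ≫ u) ≫ S.g = 0 := by
    rw [Category.assoc, hu, reassoc_of% hπ, Limits.zero_comp]
  let c : P.complex.X 1 ⟶ S.X₁ := hS.exact.lift _ hdu
  have hc : c ≫ S.f = P.complex.d 1 0 ≫ u := hS.exact.lift_f _ hdu
  have hdc : P.complex.d 2 1 ≫ c = 0 := by
    rw [← cancel_mono S.f, Category.assoc, hc]
    simp
  obtain ⟨v, hv⟩ : ∃ v : P.complex.X 0 ⟶ S.X₁, P.complex.d 1 0 ≫ v = c := by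
    have hz := (ModuleCat.isZero_of_subsingleton _).of_iso (P.isoExt (R := R) 1 S.X₁).symm
    rw [← HomologicalComplex.exactAt_iff_isZero_homology,
      HomologicalComplex.exactAt_iff' _ 0 1 2 (by simp) (by simp),
      ShortComplex.moduleCat_exact_iff] at hz
    exact hz c hdc
  have hk : P.complex.d 1 0 ≫ (u - v ≫ S.f) = 0 := by
    rw [Preadditive.comp_sub, reassoc_of% hv, hc, sub_self]
  let T := ShortComplex.mk _ _ hπ
  have hT : T.Exact := P.exact₀
  have : Epi T.g := ‹Epi π›
  refine ⟨hT.desc _ hk, ?_⟩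
  have h1 : π ≫ hT.desc _ hk = u - v ≫ S.f := hT.g_desc _ hk
  rw [← cancel_epi π, reassoc_of% h1, Preadditive.sub_comp, hu, Category.assoc, S.zero]
  simp

/-- `Ext¹(A, ℤ) = 0` lets characters of `A` lift to rational-valued homomorphisms. -/
theorem CharacterModule.exists_rat_lift_of_subsingleton_ext {A : Type} [AddCommGroup A]
    (hext : Subsingleton (((Ext ℤ (ModuleCat ℤ) 1).obj
      (Opposite.op (ModuleCat.of ℤ A))).obj (ModuleCat.of ℤ ℤ))) (χ : CharacterModule A) :
    ∃ g : A →+ ℚ, ∀ a, (g a : AddCircle (1 : ℚ)) = χ a := by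
  let i : ℤ →ₗ[ℤ] ℚ := (Int.castAddHom ℚ).toIntLinearMap
  let q : ℚ →ₗ[ℤ] AddCircle (1 : ℚ) :=
    (QuotientAddGroup.mk' (AddSubgroup.zmultiples (1 : ℚ))).toIntLinearMap
  have hiq : Function.Exact i q := fun x ↦ by
    change ((x : AddCircle (1 : ℚ)) = 0) ↔ _
    simp [AddSubgroup.mem_zmultiples_iff, i]
  have hqi : q ∘ₗ i = 0 := hiq.linearMap_comp_eq_zero
  let S : ShortComplex (ModuleCat ℤ) := ShortComplex.mk (ModuleCat.ofHom i) (ModuleCat.ofHom q)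
    (by rw [← ModuleCat.ofHom_comp, hqi]; rfl)
  have hS : S.ShortExact :=
    { exact := (ShortComplex.ShortExact.moduleCat_exact_iff_function_exact S).2 hiq
      mono_f := (ModuleCat.mono_iff_injective _).2 Int.cast_injective
      epi_g := (ModuleCat.epi_iff_surjective _).2 (QuotientAddGroup.mk'_surjective _) }
  obtain ⟨g, hg⟩ := hS.exists_lift_of_subsingleton_ext hext
    (ModuleCat.ofHom (AddMonoidHom.toIntLinearMap χ))
  exact ⟨g.hom.toAddMonoidHom, fun a ↦ congr($(hg).hom a)⟩

/-- A countable abelian group with only countably many characters is finitely generated. -/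
theorem CharacterModule.finite_of_countable {A : Type*} [AddCommGroup A] [Countable A]
    [Countable (CharacterModule A)] : Module.Finite ℤ A := by
  by_contra hA
  obtain ⟨a, ha⟩ := exists_surjective_nat A
  obtain ⟨χ, hχ⟩ := exists_surjective_nat (CharacterModule A)
  have step (n : ℕ) (p : {p : Submodule ℤ A × CharacterModule A // p.1.FG}) :
      ∃ p' : {p : Submodule ℤ A × CharacterModule A // p.1.FG}, p.1.1 ≤ p'.1.1 ∧
        a n ∈ p'.1.1 ∧ (∀ x ∈ p.1.1, p'.1.2 x = p.1.2 x) ∧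
        ∃ b ∈ p'.1.1, p'.1.2 b ≠ χ n b := by
    obtain ⟨⟨L, f⟩, hL⟩ := p
    obtain ⟨b, hb⟩ : ∃ b, b ∉ L := by
      by_contra! h
      exact hA ⟨(Submodule.eq_top_iff'.2 h) ▸ hL⟩
    obtain ⟨ψ, hψ⟩ := exists_character_apply_ne_zero_of_ne_zero
      (mt (Submodule.Quotient.mk_eq_zero L).1 hb)
    have hfg : (L ⊔ Submodule.span ℤ {a n, b}).FG :=
      hL.sup (Submodule.fg_span (Set.toFinite _))
    have hab : {a n, b} ⊆ ((L ⊔ Submodule.span ℤ {a n, b} : Submodule ℤ A) : Set A) :=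
      Submodule.subset_span.trans (SetLike.coe_subset_coe.2 le_sup_right)
    by_cases hf : f b = χ n b
    · refine ⟨⟨⟨_, f + dual L.mkQ ψ⟩, hfg⟩, le_sup_left, hab (by simp), fun x hx ↦ ?_,
        b, hab (by simp), ?_⟩
      · change f x + ψ (L.mkQ x) = f x
        rw [Submodule.mkQ_apply, (Submodule.Quotient.mk_eq_zero L).2 hx, map_zero, add_zero]
      · change f b + ψ (L.mkQ b) ≠ χ n b
        simpa [hf] using hψ
    · exact ⟨⟨⟨_, f⟩, hfg⟩, le_sup_left, hab (by simp), fun _ _ ↦ rfl, b, hab (by simp), hf⟩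
  choose next hle hmem hagree hne using step
  let p : ℕ → {p : Submodule ℤ A × CharacterModule A // p.1.FG} :=
    fun n ↦ Nat.rec ⟨(⊥, 0), Submodule.fg_bot⟩ next n
  have hmono : Monotone fun n ↦ (p n).1.1 := monotone_nat_of_le_succ fun n ↦ hle n (p n)
  have hstable {m n : ℕ} (hmn : m ≤ n) : ∀ x ∈ (p m).1.1, (p n).1.2 x = (p m).1.2 x := by
    induction n, hmn using Nat.le_induction with
    | base => exact fun _ _ ↦ rfl
    | succ n hmn ih => exact fun x hx ↦ (hagree n (p n) x (hmono hmn hx)).trans (ih x hx)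
  have hex (x : A) : ∃ n, x ∈ (p n).1.1 := by
    obtain ⟨n, rfl⟩ := ha x
    exact ⟨n + 1, hmem n (p n)⟩
  choose N hN using hex
  have hval {n : ℕ} {x : A} (hx : x ∈ (p n).1.1) : (p (N x)).1.2 x = (p n).1.2 x := by
    rcases le_total n (N x) with h | h
    · exact hstable h x hx
    · exact (hstable h x (hN x)).symm
  let f : CharacterModule A := AddMonoidHom.mk' (fun x ↦ (p (N x)).1.2 x) fun x y ↦ by
    have hx := hmono (le_max_left (N x) (N y)) (hN x)
    have hy := hmono (le_max_right (N x) (N y)) (hN y)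
    rw [hval hx, hval hy, hval (add_mem hx hy), map_add]
  obtain ⟨n, hn⟩ := hχ f
  obtain ⟨b, hb, hfb⟩ := hne n (p n)
  refine hfb ?_
  rw [hn]
  exact (hval (n := n + 1) hb).symm

/-- The elements of a `ℤ`-module having a nonzero multiple in a given submodule. -/
def Submodule.pureClosure {A : Type*} [AddCommGroup A] (S : Submodule ℤ A) : Submodule ℤ A :=
  (torsion ℤ (A ⧸ S)).comap S.mkQ

namespace Submodule

variable {A : Type*} [AddCommGroup A]

theorem mem_pureClosure {S : Submodule ℤ A} {x : A} :
    x ∈ S.pureClosure ↔ ∃ m : ℤ, m ≠ 0 ∧ m • x ∈ S := by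
  simp only [pureClosure, mem_comap, mem_torsion_iff, mkQ_apply, Subtype.exists,
    mem_nonZeroDivisors_iff_ne_zero, Submonoid.mk_smul, ← Quotient.mk_smul, Quotient.mk_eq_zero,
    exists_prop]

theorem le_pureClosure (S : Submodule ℤ A) : S ≤ S.pureClosure :=
  fun x hx ↦ mem_pureClosure.2 ⟨1, one_ne_zero, by simpa⟩

theorem pureClosure_mono : Monotone (pureClosure (A := A)) := fun _ _ h _ hx ↦
  let ⟨m, hm, hmx⟩ := mem_pureClosure.1 hx
  mem_pureClosure.2 ⟨m, hm, h hmx⟩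

instance isTorsionFree_quotient_pureClosure (S : Submodule ℤ A) :
    Module.IsTorsionFree ℤ (A ⧸ S.pureClosure) := by
  refine .of_smul_eq_zero fun m x hx ↦ ?_
  induction x using Quotient.induction_on with | _ x
  rw [← Quotient.mk_smul, Quotient.mk_eq_zero] at hx
  refine or_iff_not_imp_left.2 fun hm ↦ ?_
  obtain ⟨k, hk, hkx⟩ := mem_pureClosure.1 hx
  exact (Quotient.mk_eq_zero _).2
    (mem_pureClosure.2 ⟨k * m, mul_ne_zero hk hm, by rwa [mul_smul]⟩)

/-- Homomorphisms to `ℚ` from the pure closure of a finitely generated group are determined by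
their values on the generators. -/
theorem countable_pureClosure_span_addMonoidHom_rat {t : Set A} (ht : t.Finite) :
    Countable ((span ℤ t).pureClosure →+ ℚ) := by
  have := ht.to_subtype
  have hsub (x : t) : (x : A) ∈ (span ℤ t).pureClosure := le_pureClosure _ (subset_span x.2)
  refine Function.Injective.countable (β := t → ℚ) (f := fun h x ↦ h ⟨x, hsub x⟩) fun g h hgh ↦ ?_
  have hspan : span ℤ t ≤ (LinearMap.eqLocus g.toIntLinearMap h.toIntLinearMap).map
      (span ℤ t).pureClosure.subtype :=
    span_le.2 fun x hx ↦ ⟨⟨x, hsub ⟨x, hx⟩⟩, congr_fun hgh ⟨x, hx⟩, rfl⟩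
  ext ⟨x, hx⟩
  obtain ⟨m, hm, hmx⟩ := mem_pureClosure.1 hx
  obtain ⟨y, hy, hyx⟩ := hspan hmx
  obtain rfl : y = m • ⟨x, hx⟩ := Subtype.ext hyx
  have : g (m • ⟨x, hx⟩) = h (m • ⟨x, hx⟩) := hy
  rw [map_zsmul, map_zsmul] at this
  exact smul_right_injective ℚ hm this

/-- A linearly independent set spanning `S` extends to one spanning a larger finitely generated
`T` if the quotient by `S` is torsion-free. -/
theorem exists_linearIndepOn_id_span_eq {S T : Submodule ℤ A} [Module.IsTorsionFree ℤ (A ⧸ S)]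
    (hST : S ≤ T) (hT : T.FG) {s : Set A} (hs : LinearIndepOn ℤ id s) (hsS : span ℤ s = S) :
    ∃ t, s ⊆ t ∧ LinearIndepOn ℤ id t ∧ span ℤ t = T := by
  have : Module.Finite ℤ (T.map S.mkQ) := .of_fg (hT.map _)
  let b := Module.Free.chooseBasis ℤ (T.map S.mkQ)
  choose v hvT hvb using fun i ↦ (b i).2
  have hvb' : S.mkQ ∘ v = (T.map S.mkQ).subtype ∘ b := funext hvb
  have hb : LinearIndependent ℤ (S.mkQ ∘ v) := by
    rw [hvb']
    exact b.linearIndependent.map' _ (ker_subtype _)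
  have hspan : (span ℤ (Set.range v)).map S.mkQ = T.map S.mkQ := by
    rw [map_span, ← Set.range_comp, hvb', Set.range_comp, ← map_span, b.span_eq,
      map_subtype_top]
  refine ⟨s ∪ Set.range v, Set.subset_union_left,
    hs.union_id_of_quotient (hsS ▸ subset_span)
      ((linearIndepOn_range_iff hb.injective.of_comp _).2 hb), ?_⟩
  rw [span_union, hsS]
  have := congr_arg (comap S.mkQ) hspan
  rwa [comap_map_mkQ, comap_map_mkQ, sup_eq_right.2 hST] at this

end Submodule

/-- **Pontryagin's criterion**: a countable abelian group is free as soon as it is torsion-free and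
the pure closure of every finite subset is finitely generated. -/
theorem Module.free_int_of_fg_pureClosure {A : Type*} [AddCommGroup A] [Countable A]
    (hbot : (⊥ : Submodule ℤ A).pureClosure = ⊥)
    (hfg : ∀ t : Set A, t.Finite → (Submodule.span ℤ t).pureClosure.FG) : Module.Free ℤ A := by
  obtain ⟨a, ha⟩ := exists_surjective_nat A
  let T (n : ℕ) : Submodule ℤ A := (Submodule.span ℤ (a '' Set.Iio n)).pureClosure
  have hT (n : ℕ) : T n ≤ T (n + 1) := Submodule.pureClosure_mono
    (Submodule.span_mono (Set.image_mono (Set.Iio_subset_Iio n.le_succ)))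
  have step (n : ℕ) (s : {s : Set A // LinearIndepOn ℤ id s ∧ Submodule.span ℤ s = T n}) :
      ∃ t : {t : Set A // LinearIndepOn ℤ id t ∧ Submodule.span ℤ t = T (n + 1)},
        s.1 ⊆ t.1 := by
    obtain ⟨t, hst, ht⟩ := Submodule.exists_linearIndepOn_id_span_eq (hT n)
      (hfg _ ((Set.finite_Iio _).image a)) s.2.1 s.2.2
    exact ⟨⟨t, ht⟩, hst⟩
  choose next hnext using step
  let s : (n : ℕ) → {s : Set A // LinearIndepOn ℤ id s ∧ Submodule.span ℤ s = T n} :=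
    fun n ↦ Nat.rec ⟨∅, linearIndepOn_empty _ _, by simp [T, hbot]⟩ next n
  have hmono : Monotone fun n ↦ (s n).1 := monotone_nat_of_le_succ fun n ↦ hnext n (s n)
  have hli : LinearIndepOn ℤ id (⋃ n, (s n).1) :=
    linearIndepOn_iUnion_of_directed hmono.directed_le fun n ↦ (s n).2.1
  refine .of_basis (Basis.mk hli fun x _ ↦ ?_)
  obtain ⟨n, rfl⟩ := ha x
  have hx : a n ∈ Submodule.span ℤ (s (n + 1)).1 := by
    rw [(s (n + 1)).2.2]
    exact Submodule.le_pureClosure _ (Submodule.subset_span ⟨n, n.lt_succ_self, rfl⟩)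
  simpa only [id_eq, Subtype.range_coe_subtype, Set.ofPred_mem_eq] using
    Submodule.span_mono (Set.subset_iUnion (fun n ↦ (s n).1) (n + 1)) hx

/-- **Stein–Serre theorem**: every countable abelian group `A` with `Ext¹_ℤ(A, ℤ) = 0`
is a free abelian group (a free `ℤ`-module). -/
theorem stein_serre (A : Type) [AddCommGroup A] [Countable A]
    (hext : Subsingleton (((Ext ℤ (ModuleCat ℤ) 1).obj
      (Opposite.op (ModuleCat.of ℤ A))).obj (ModuleCat.of ℤ ℤ))) :
    Module.Free ℤ A := by
  have hlift := CharacterModule.exists_rat_lift_of_subsingleton_ext hext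
  refine Module.free_int_of_fg_pureClosure ((Submodule.eq_bot_iff _).2 fun x hx ↦ ?_)
    fun t ht ↦ ?_
  · obtain ⟨m, hm, hmx⟩ := Submodule.mem_pureClosure.1 hx
    refine CharacterModule.eq_zero_of_character_apply fun χ ↦ ?_
    obtain ⟨g, hg⟩ := hlift χ
    have hgx : m • g x = 0 := by rw [← map_zsmul, (Submodule.mem_bot ℤ).1 hmx, map_zero]
    rw [← hg, (smul_eq_zero.1 hgx).resolve_left hm, AddCircle.coe_zero]
  · have := Submodule.countable_pureClosure_span_addMonoidHom_rat ht
    have : Countable (CharacterModule (Submodule.span ℤ t).pureClosure) := by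
      refine Function.Surjective.countable
        (f := fun g : (Submodule.span ℤ t).pureClosure →+ ℚ ↦
          ((QuotientAddGroup.mk' (AddSubgroup.zmultiples (1 : ℚ))).comp g : CharacterModule _))
        fun χ ↦ ?_
      obtain ⟨χ, rfl⟩ := CharacterModule.dual_surjective_of_injective _
        (Submodule.span ℤ t).pureClosure.injective_subtype χ
      obtain ⟨g, hg⟩ := hlift χ
      exact ⟨g.comp (Submodule.span ℤ t).pureClosure.subtype.toAddMonoidHom,
        CharacterModule.ext _ fun x ↦ hg x⟩
    have := CharacterModule.finite_of_countable (A := (Submodule.span ℤ t).pureClosure)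
    exact Module.Finite.iff_fg.1 this
end

section
/- Algebraic content of Lemma 7 (equivalence of ℤ-acyclicity in Čech cohomology and Steenrod–Sitnikov homology via the universal coefficient sequences): let (A_n)_{n∈ℤ} and (B_n)_{n∈ℤ} be families of abelian groups such that each B_n is countable, and suppose for each n ∈ ℤ there is an exact sequence 0 → Ext¹_ℤ(B_{n+1}, ℤ) → A_n → Hom_ℤ(B_n, ℤ) → 0 (that is, an injective group homomorphism from Ext¹_ℤ(B_{n+1}, ℤ) into A_n whose image equals the kernel of a surjective group homomorphism from A_n onto Hom_ℤ(B_n, ℤ)). Then A_n = 0 for all n ∈ ℤ if and only if B_n = 0 for all n ∈ ℤ. -/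
open CategoryTheory

open Limits in
/-- If `Ext¹(X, Y)` vanishes, then every cocycle of degree one of a projective resolution of
`X` with values in `Y` is a coboundary. -/
lemma CategoryTheory.ProjectiveResolution.exists_eq_d_comp_of_isZero_ext {R : Type*} [Ring R]
    {C : Type*} [Category* C] [Abelian C] [Linear R C] [EnoughProjectives C] {X Y : C}
    (P : ProjectiveResolution X) (hX : IsZero (((Ext R C 1).obj (Opposite.op X)).obj Y))
    (c : P.complex.X 1 ⟶ Y) (hc : P.complex.d 2 1 ≫ c = 0) :
    ∃ k : P.complex.X 0 ⟶ Y, c = P.complex.d 1 0 ≫ k := by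
  have h₀ := hX.of_iso (P.isoExt (R := R) 1 Y).symm
  rw [← HomologicalComplex.exactAt_iff_isZero_homology,
    HomologicalComplex.exactAt_iff' _ 0 1 2 (by simp) (by simp),
    ShortComplex.moduleCat_exact_iff] at h₀
  obtain ⟨k, hk⟩ := h₀ c hc
  exact ⟨k, hk.symm⟩

open Limits in
/-- If `Ext¹(X, S.X₁)` vanishes for a short exact sequence `S`, then every morphism `X ⟶ S.X₃`
lifts to `S.X₂`. -/
lemma CategoryTheory.ShortComplex.ShortExact.exists_lift_of_isZero_ext {R : Type*} [Ring R]
    {C : Type*} [Category* C] [Abelian C] [Linear R C] [EnoughProjectives C]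
    {S : ShortComplex C} (hS : S.ShortExact) {X : C}
    (hX : IsZero (((Ext R C 1).obj (Opposite.op X)).obj S.X₁)) (f : X ⟶ S.X₃) :
    ∃ g : X ⟶ S.X₂, g ≫ S.g = f := by
  have := hS.mono_f
  have := hS.epi_g
  let P := ProjectiveResolution.of X
  let p : P.complex.X 0 ⟶ X := P.π.f 0
  have hp : P.complex.d 1 0 ≫ p = 0 := P.complex_d_comp_π_f_zero
  have : Epi p := inferInstanceAs (Epi (P.π.f 0))
  let l := Projective.factorThru (p ≫ f) S.g
  have hl : l ≫ S.g = p ≫ f := Projective.factorThru_comp _ _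
  have hdl : (P.complex.d 1 0 ≫ l) ≫ S.g = 0 := by
    rw [Category.assoc, hl, ← Category.assoc, hp, zero_comp]
  let c := hS.exact.lift _ hdl
  have hc : c ≫ S.f = P.complex.d 1 0 ≫ l := hS.exact.lift_f _ _
  have hdc : P.complex.d 2 1 ≫ c = 0 := by
    rw [← cancel_mono S.f, Category.assoc, hc, P.complex.d_comp_d_assoc, zero_comp, zero_comp]
  obtain ⟨k, hk⟩ := P.exists_eq_d_comp_of_isZero_ext hX c hdc
  have hker : P.complex.d 1 0 ≫ (l - k ≫ S.f) = 0 := by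
    rw [Preadditive.comp_sub, ← hc, hk, Category.assoc, sub_self]
  obtain ⟨g, hg⟩ : ∃ g : X ⟶ S.X₂, p ≫ g = l - k ≫ S.f :=
    let d := CokernelCofork.IsColimit.desc' P.isColimitCokernelCofork _ hker
    ⟨d.1, d.2⟩
  refine ⟨g, ?_⟩
  rw [← cancel_epi p, ← Category.assoc, hg, Preadditive.sub_comp, Category.assoc, S.zero,
    comp_zero, sub_zero, hl]

/-- A rational number vanishes in `ℚ/ℤ` exactly when it is an integer. -/
lemma AddCircle.coe_rat_eq_zero_iff {x : ℚ} :
    (x : AddCircle (1 : ℚ)) = 0 ↔ ∃ z : ℤ, (z : ℚ) = x := by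
  rw [AddCircle.coe_eq_zero_iff]
  simp

/-- If `Ext¹(B, ℤ)` vanishes, then every character `B → ℚ/ℤ` lifts to a homomorphism `B → ℚ`. -/
lemma CharacterModule.exists_rat_lift {B : Type} [AddCommGroup B]
    (hB : Subsingleton (((Ext ℤ (ModuleCat ℤ) 1).obj
      (Opposite.op (ModuleCat.of ℤ B))).obj (ModuleCat.of ℤ ℤ)))
    (f : CharacterModule B) : ∃ g : B →+ ℚ, ∀ x, (g x : AddCircle (1 : ℚ)) = f x := by
  let i : ℤ →ₗ[ℤ] ℚ := (Int.castAddHom ℚ).toIntLinearMap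
  let q : ℚ →ₗ[ℤ] AddCircle (1 : ℚ) :=
    (QuotientAddGroup.mk' (AddSubgroup.zmultiples (1 : ℚ))).toIntLinearMap
  have hiq : Function.Exact i q :=
    fun _ ↦ AddCircle.coe_rat_eq_zero_iff
  have hS : (ShortComplex.mk (ModuleCat.ofHom i) (ModuleCat.ofHom q)
      (by rw [← ModuleCat.ofHom_comp, hiq.linearMap_comp_eq_zero]; rfl)).ShortExact :=
    { exact := (ShortComplex.ShortExact.moduleCat_exact_iff_function_exact _).2 hiq
      mono_f := (ModuleCat.mono_iff_injective _).2 Int.cast_injective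
      epi_g := (ModuleCat.epi_iff_surjective _).2 (QuotientAddGroup.mk'_surjective _) }
  obtain ⟨g, hg⟩ := hS.exists_lift_of_isZero_ext (R := ℤ) (ModuleCat.isZero_of_subsingleton _)
    (ModuleCat.ofHom (X := B) (Y := AddCircle (1 : ℚ)) (AddMonoidHom.toIntLinearMap f))
  exact ⟨g.hom.toAddMonoidHom, fun x ↦ congrArg (fun φ ↦ φ.hom x) hg⟩

/-- An integer divisible by all powers of three is zero. -/
lemma Int.eq_zero_of_forall_three_pow_dvd {z : ℤ} (h : ∀ k : ℕ, 3 ^ k ∣ z) : z = 0 := by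
  by_contra hz
  exact (FiniteMultiplicity.not_iff_forall.2 h)
    (Int.finiteMultiplicity_iff.2 ⟨by decide, hz⟩)

/-- If `B` has no nonzero homomorphism to `ℤ` and all its characters lift to `ℚ`, then `B` is
divisible. -/
lemma exists_nsmul_eq_of_rat_lift {B : Type*} [AddCommGroup B] (hom : Subsingleton (B →+ ℤ))
    (lift : ∀ f : CharacterModule B, ∃ g : B →+ ℚ, ∀ x, (g x : AddCircle (1 : ℚ)) = f x)
    {m : ℕ} (hm : m ≠ 0) (b : B) : ∃ c, m • c = b := by
  let N := (nsmulAddMonoidHom (α := B) m).range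
  suffices (QuotientAddGroup.mk' N b) = 0 from (QuotientAddGroup.eq_zero_iff b).1 this
  refine CharacterModule.eq_zero_of_character_apply fun χ ↦ ?_
  obtain ⟨g, hg⟩ := lift (AddMonoidHom.comp χ (QuotientAddGroup.mk' N))
  have hint (x : B) : ∃ z : ℤ, (z : ℚ) = m • g x := by
    have h0 : QuotientAddGroup.mk' N (m • x) = 0 := (QuotientAddGroup.eq_zero_iff _).2 ⟨x, rfl⟩
    have h1 : ((m • g x : ℚ) : AddCircle (1 : ℚ)) = 0 := by
      rw [← map_nsmul, hg]
      exact (congrArg χ h0).trans (map_zero χ)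
    exact AddCircle.coe_rat_eq_zero_iff.1 h1
  choose z hz using hint
  have hzero : z b = 0 := DFunLike.congr_fun (Subsingleton.elim
    (AddMonoidHom.mk' z fun x y ↦ by
      rw [← Int.cast_inj (α := ℚ), Int.cast_add, hz, hz, hz, map_add, nsmul_add]) 0) b
  have hgb : g b = 0 := by
    have := hz b
    rw [hzero] at this
    simpa [hm] using this.symm
  have := hg b
  rw [hgb] at this
  exact this.symm

/-- If all characters of `B` lift to `ℚ`, then `B` is torsion-free. -/
lemma eq_zero_of_zsmul_eq_zero_of_rat_lift {B : Type*} [AddCommGroup B]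
    (lift : ∀ f : CharacterModule B, ∃ g : B →+ ℚ, ∀ x, (g x : AddCircle (1 : ℚ)) = f x)
    {m : ℤ} (hm : m ≠ 0) {b : B} (hb : m • b = 0) : b = 0 := by
  refine CharacterModule.eq_zero_of_character_apply fun χ ↦ ?_
  obtain ⟨g, hg⟩ := lift χ
  have : m • g b = 0 := by rw [← map_zsmul, hb, map_zero]
  rw [← hg, (smul_eq_zero_iff_right hm).1 this]
  rfl

/-- If `B` has no nonzero homomorphism to `ℤ` and all its characters lift to `ℚ`, then `B`
vanishes. -/
lemma subsingleton_of_rat_lift {B : Type*} [AddCommGroup B] (hom : Subsingleton (B →+ ℤ))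
    (lift : ∀ f : CharacterModule B, ∃ g : B →+ ℚ, ∀ x, (g x : AddCircle (1 : ℚ)) = f x) :
    Subsingleton B := by
  refine subsingleton_of_forall_eq 0 fun b ↦ ?_
  obtain ⟨c, rfl⟩ := exists_nsmul_eq_of_rat_lift hom lift two_ne_zero b
  -- A character which kills the elements `2c / 3ᵏ` lifts to a map killing `2c`, hence `c`.
  let N : AddSubgroup B :=
    { carrier := {x | ∃ (k : ℕ) (m : ℤ), (3 ^ k : ℤ) • x = m • (2 • c)}
      zero_mem' := ⟨0, 0, by simp⟩
      neg_mem' := by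
        rintro x ⟨k, m, h⟩
        exact ⟨k, -m, by rw [smul_neg, h, neg_smul]⟩
      add_mem' := by
        rintro x y ⟨k, m, hx⟩ ⟨l, n, hy⟩
        refine ⟨k + l, 3 ^ l * m + 3 ^ k * n, ?_⟩
        rw [add_smul, mul_smul, mul_smul, ← hx, ← hy, smul_add, smul_smul, smul_smul, pow_add,
          mul_comm ((3 : ℤ) ^ l)] }
  have hc : QuotientAddGroup.mk' N c = 0 := by
    refine CharacterModule.eq_zero_of_character_apply fun χ ↦ ?_
    obtain ⟨g, hg⟩ := lift (AddMonoidHom.comp χ (QuotientAddGroup.mk' N))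
    have hint (x : B) (hx : x ∈ N) : ∃ z : ℤ, (z : ℚ) = g x := by
      have h0 : QuotientAddGroup.mk' N x = 0 := (QuotientAddGroup.eq_zero_iff _).2 hx
      have h1 : (g x : AddCircle (1 : ℚ)) = 0 := by
        rw [hg]
        exact (congrArg χ h0).trans (map_zero χ)
      exact AddCircle.coe_rat_eq_zero_iff.1 h1
    obtain ⟨z, hz⟩ := hint (2 • c) ⟨0, 1, by simp⟩
    have hz0 : z = 0 := Int.eq_zero_of_forall_three_pow_dvd fun k ↦ by
      obtain ⟨x, hx⟩ := exists_nsmul_eq_of_rat_lift hom lift (m := 3 ^ k) (by positivity) (2 • c)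
      obtain ⟨w, hw⟩ := hint x ⟨k, 1, by rw [one_smul, ← hx, ← natCast_zsmul]; push_cast; rfl⟩
      refine ⟨w, ?_⟩
      rw [← Int.cast_inj (α := ℚ), hz, ← hx, map_nsmul, ← hw]
      simp
    have hgc : g c = 0 := by
      rw [hz0, map_nsmul] at hz
      simpa using hz.symm
    have := hg c
    rw [hgc] at this
    exact this.symm
  obtain ⟨k, m, h⟩ := (QuotientAddGroup.eq_zero_iff c).1 hc
  have hodd : (3 ^ k - m * 2 : ℤ) ≠ 0 := by
    have : Odd ((3 : ℤ) ^ k) := Odd.pow (by decide)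
    intro h0
    obtain ⟨r, hr⟩ := this
    omega
  have hc0 : c = 0 := eq_zero_of_zsmul_eq_zero_of_rat_lift lift hodd (by
    rw [sub_smul, h, mul_smul, sub_eq_zero, ofNat_zsmul])
  rw [hc0, smul_zero]


/-- Algebraic content of Lemma 7: if `(Aₙ)` and `(Bₙ)` are families of abelian groups with
each `Bₙ` countable, related for every `n` by a universal-coefficient exact sequence
`0 → Ext¹_ℤ(B_{n+1}, ℤ) → Aₙ → Hom_ℤ(Bₙ, ℤ) → 0`, then all `Aₙ` vanish if and only if
all `Bₙ` vanish. -/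
theorem acyclicity_equivalence (A B : ℤ → Type) [∀ n, AddCommGroup (A n)]
    [∀ n, AddCommGroup (B n)] [∀ n, Countable (B n)]
    (h : ∀ n : ℤ, ∃ (ι : (((Ext ℤ (ModuleCat ℤ) 1).obj
          (Opposite.op (ModuleCat.of ℤ (B (n + 1))))).obj (ModuleCat.of ℤ ℤ)) →+ A n)
        (π : A n →+ (B n →+ ℤ)),
        Function.Injective ι ∧ Function.Surjective π ∧
          AddMonoidHom.range ι = AddMonoidHom.ker π) :
    (∀ n : ℤ, Subsingleton (A n)) ↔ (∀ n : ℤ, Subsingleton (B n)) := by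
  constructor
  · intro hA n
    refine subsingleton_of_rat_lift ?_ (CharacterModule.exists_rat_lift ?_)
    · obtain ⟨_, π, -, hπ, -⟩ := h n
      exact hπ.subsingleton
    · obtain ⟨m, rfl⟩ : ∃ m, n = m + 1 := ⟨n - 1, by simp⟩
      obtain ⟨ι, _, hι, -, -⟩ := h m
      exact hι.subsingleton
  · intro hB n
    obtain ⟨ι, π, -, -, hex⟩ := h n
    have hE := ModuleCat.subsingleton_of_isZero (isZero_Ext_succ_of_projective (R := ℤ)
      (ModuleCat.of ℤ (B (n + 1))) (ModuleCat.of ℤ ℤ) 0)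
    refine subsingleton_of_forall_eq 0 fun a ↦ ?_
    have ha : a ∈ π.ker := DFunLike.ext _ _ fun b ↦ by
      rw [Subsingleton.elim b 0, map_zero, map_zero]
    rw [← hex] at ha
    obtain ⟨e, rfl⟩ := ha
    rw [Subsingleton.elim e 0, map_zero]
end
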